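/- arXiv:1512.06509 — 2 statements merged into one kernel-verified Lean document; each statement's English description precedes it below -/
import Mathlib

section
/- Assume σ := 2·min{s_1, …, s_m} - 1 > 0 and let u : ℝ^n → ℝ be a classical solution of L u = 0 in the whole of ℝ^n with ‖u‖_{L^∞(B_R)} = o(R^σ) as R → +∞. Then the function w : ℝ^{n-1} → ℝ defined by w(x_1, …, x_{n-1}) := u(x_1, …, x_{n-1}, 0) satisfies Σ_{i=1}^{m-1} a_i (-Δ_{X_i})^{s_i} w(x') = 0 for every x' ∈ ℝ^{n-1}, where the operators (-Δ_{X_i})^{s_i} now act on functions of ℝ^{n-1} = ℝ^{N_1} × … × ℝ^{N_{m-1}} by the same formulas in the i-th coordinate group. -/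
open MeasureTheory Real Filter

noncomputable section

/-- The normalization constant `c_{N,s}`. -/
def cns (N : ℕ) (s : ℝ) : ℝ :=
  2 ^ (2 * s - 1) * Real.Gamma (s + (N : ℝ) / 2) /
    (Real.pi ^ ((N : ℝ) / 2) * |Real.Gamma (-s)|)

/-- The constant `η_i`. -/
def etaC (N : ℕ) (s : ℝ) : ℝ :=
  Real.Gamma ((N : ℝ) / 2) /
    (2 ^ (2 * s) * Real.Gamma (s + 1) * Real.Gamma (s + (N : ℝ) / 2))

/-- `ℝ^n` with coordinates grouped according to `N : ι → ℕ`. -/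
abbrev GS {ι : Type*} (N : ι → ℕ) : Type _ :=
  PiLp 2 (fun i : ι => EuclideanSpace ℝ (Fin (N i)))

/-- The inclusion `y ↦ y^{(i)}`. -/
def grpIncl {ι : Type*} [DecidableEq ι] (N : ι → ℕ) (i : ι)
    (y : EuclideanSpace ℝ (Fin (N i))) : GS N :=
  WithLp.toLp 2 (Pi.single i y)

/-- Second derivative of `u` at `x` in direction `v`. -/
def dirD2 {E : Type*} [NormedAddCommGroup E] [NormedSpace ℝ E]
    (u : E → ℝ) (x v : E) : ℝ :=
  iteratedDeriv 2 (fun t : ℝ => u (x + t • v)) 0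

/-- The operator `(-Δ_{X_i})^{s_i}`. -/
def gLap {ι : Type*} [Fintype ι] [DecidableEq ι] (N : ι → ℕ) (i : ι) (si : ℝ)
    (u : GS N → ℝ) (x : GS N) : ℝ :=
  if si = 1 then
    -∑ j : Fin (N i), dirD2 u x (grpIncl N i (EuclideanSpace.single j 1))
  else
    cns (N i) si *
      ∫ y : EuclideanSpace ℝ (Fin (N i)),
        (2 * u x - u (x + grpIncl N i y) - u (x - grpIncl N i y)) /
          ‖y‖ ^ ((N i : ℝ) + 2 * si)

/-- Absolute convergence of the integral defining `(-Δ_{X_i})^{s_i} u (x)`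
(trivial in the local case `s_i = 1`). -/
def gInt {ι : Type*} [Fintype ι] [DecidableEq ι] (N : ι → ℕ) (i : ι) (si : ℝ)
    (u : GS N → ℝ) (x : GS N) : Prop :=
  si = 1 ∨ Integrable (fun y : EuclideanSpace ℝ (Fin (N i)) =>
    (2 * u x - u (x + grpIncl N i y) - u (x - grpIncl N i y)) /
      ‖y‖ ^ ((N i : ℝ) + 2 * si))

/-- The operator `L = Σ_i a_i (-Δ_{X_i})^{s_i}`. -/
def Lop {ι : Type*} [Fintype ι] [DecidableEq ι] (N : ι → ℕ) (a s : ι → ℝ)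
    (u : GS N → ℝ) (x : GS N) : ℝ :=
  ∑ i, a i * gLap N i (s i) u x

/-- `u` is a classical solution of `L u = f` in `Ω`. -/
def IsSol {ι : Type*} [Fintype ι] [DecidableEq ι] (N : ι → ℕ) (a s : ι → ℝ)
    (u f : GS N → ℝ) (Ω : Set (GS N)) : Prop :=
  Continuous u ∧ ∀ x ∈ Ω, ContDiffAt ℝ 2 u x ∧ (∀ i, gInt N i (s i) u x) ∧
    Lop N a s u x = f x

/-- The unit vector `e_n` (the last group has one coordinate). -/
def eN {m : ℕ} (N : Fin (m + 1) → ℕ) : GS N :=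
  grpIncl N (Fin.last m) (WithLp.toLp 2 (fun _ => (1 : ℝ)))

/-- The box `Q_{d,κ}`. -/
def Qset {m : ℕ} (N : Fin (m + 1) → ℕ) (d : Fin (m + 1) → ℝ) (κ : ℝ) :
    Set (GS N) :=
  {x | (∀ i, i ≠ Fin.last m → ‖x i‖ < d i) ∧
    ‖x (Fin.last m)‖ < κ * d (Fin.last m)}

/-- The cube `(-c,c)^n`. -/
def gCube {m : ℕ} (N : Fin (m + 1) → ℕ) (c : ℝ) : Set (GS N) :=
  {x | ∀ (i : Fin (m + 1)) (j : Fin (N i)), |x i j| < c}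

/-- `ℋ^{N-1}(S^{N-1})`. -/
def sphVol (n : ℕ) : ℝ :=
  (μH[(n : ℝ) - 1] (Metric.sphere (0 : EuclideanSpace ℝ (Fin n)) 1)).toReal

/-- The operator `L_*` acting on functions of `(x,t) ∈ ℝ^n × ℝ`. -/
def LstarOp {m : ℕ} (N : Fin (m + 1) → ℕ) (a s : Fin (m + 1) → ℝ) (ν : ℝ)
    (h : GS N × ℝ → ℝ) (p : GS N × ℝ) : ℝ :=
  (∑ i ∈ Finset.univ.erase (Fin.last m),
      a i * gLap N i (s i) (fun z => h (z, p.2)) p.1)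
    - (a (Fin.last m) - ν) * dirD2 (fun z => h (z, p.2)) p.1 (eN N)
    - ν * dirD2 (fun τ : ℝ => h (p.1, τ)) p.2 1

/-- The barrier `Φ`. -/
def PhiBar {m : ℕ} (N : Fin (m + 1) → ℕ) (s d : Fin (m + 1) → ℝ)
    (ν A₁ A₂ : ℝ) (p : GS N × ℝ) : ℝ :=
  A₁ / ν * (max p.2 0 * max (d (Fin.last m) - p.2) 0 / 2)
    + A₂ * ((∑ i, etaC (N i) (s i) * d i ^ (2 * s i))
        + d (Fin.last m) ^ 2 / 2
        - ∑ i, etaC (N i) (s i) * max (d i ^ 2 - ‖p.1 i‖ ^ 2) 0 ^ s i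
        - max (d (Fin.last m) ^ 2 - p.2 ^ 2) 0 / 2)

/-- `sup` of `|u|` on the open annulus `B_{2ρ} ∖ closure(B_{ρ/2})`. -/
def annSup {n : ℕ} (u : EuclideanSpace ℝ (Fin n) → ℝ) (ρ : ℝ) : ℝ :=
  sSup ((fun x => |u x|) '' {x | ρ / 2 < ‖x‖ ∧ ‖x‖ < 2 * ρ})

/-- `sup` of `|u|` on the open ball `B_r`. -/
def ballSup {n : ℕ} (u : EuclideanSpace ℝ (Fin n) → ℝ) (r : ℝ) : ℝ :=
  sSup ((fun x => |u x|) '' Metric.ball 0 r)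


def sdf {E : Type*} [AddCommGroup E] (u : E → ℝ) (p y : E) : ℝ := u (p + y) + u (p - y) - 2 * u p

lemma second_le {g : ℝ → ℝ} (hg : ContDiff ℝ 2 g) {B : ℝ}
    (h : ∀ᶠ t in nhds (0:ℝ), g t + g (-t) - 2 * g 0 ≤ B * t ^ 2) :
    iteratedDeriv 2 g 0 ≤ B := by
  have hg1 : Differentiable ℝ g := hg.differentiable (by norm_num)
  have hg2 : Differentiable ℝ (deriv g) := by
    have : ContDiff ℝ 1 (deriv g) := by
      have := (contDiff_succ_iff_deriv (n := 1) (f := g) (𝕜 := ℝ)).1 (by rw [one_add_one_eq_two]; exact hg)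
      exact this.2.2
    exact this.differentiable (by norm_num)
  have e2 : iteratedDeriv 2 g 0 = deriv (deriv g) 0 := by
    rw [iteratedDeriv_succ, iteratedDeriv_one]
  rw [e2]
  by_contra hcon
  push Not at hcon
  set H : ℝ → ℝ := fun t => g t + g (-t) - 2 * g 0 - B * t ^ 2 with hH
  have d1 : deriv H = fun t => deriv g t - deriv g (-t) - B * (2 * t) := by
    funext t
    have a1 := (hg1 t).hasDerivAt
    have a2 : HasDerivAt (fun t => g (-t)) (-deriv g (-t)) t := by
      have := (hg1 (-t)).hasDerivAt.comp t (hasDerivAt_neg t)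
      simpa [Function.comp_def] using this
    have a3 : HasDerivAt (fun t : ℝ => B * t ^ 2) (B * (2 * t)) t := by
      simpa using (hasDerivAt_pow 2 t).const_mul B
    have := (((a1.add a2).sub_const (2 * g 0)).sub a3).deriv
    rw [sub_eq_add_neg (deriv g t)]
    exact this
  have d2 : deriv (deriv H) 0 = 2 * deriv (deriv g) 0 - 2 * B := by
    rw [d1]
    have a1 := (hg2 0).hasDerivAt
    have a2 : HasDerivAt (fun t => deriv g (-t)) (-deriv (deriv g) 0) 0 := by
      have := HasDerivAt.comp (0:ℝ) (by simpa using (hg2 0).hasDerivAt : HasDerivAt (deriv g) (deriv (deriv g) 0) (-0)) (hasDerivAt_neg (0:ℝ))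
      simpa [Function.comp_def] using this
    have a3 : HasDerivAt (fun t : ℝ => B * (2 * t)) (B * (2 * 1)) 0 :=
      ((hasDerivAt_id (0:ℝ)).const_mul 2).const_mul B
    have := ((a1.sub a2).sub a3).deriv
    refine Eq.trans this ?_
    ring
  have hc : ContinuousAt H 0 := by
    have := hg1.continuous
    fun_prop
  have hmin := isLocalMin_of_deriv_deriv_pos (f := H) (x₀ := 0) (by rw [d2]; linarith)
    (by rw [d1]; simp) hc
  have hz : H =ᶠ[nhds 0] fun _ => (0:ℝ) := by
    filter_upwards [hmin, h] with t h1 h2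
    have : H 0 = 0 := by simp [hH]; ring
    rw [this] at h1
    have : H t ≤ 0 := by simp only [hH]; linarith
    linarith
  have := hz.deriv.deriv.self_of_nhds
  rw [d2] at this
  simp at this
  linarith

lemma dirD2_le {E : Type*} [NormedAddCommGroup E] [NormedSpace ℝ E] {u : E → ℝ}
    (hu : ContDiff ℝ 2 u) (p q b : E) {B : ℝ}
    (h : ∀ᶠ t in nhds (0:ℝ), sdf u p (t • b) - sdf u q (t • b) ≤ B * t ^ 2) :
    dirD2 u p b - dirD2 u q b ≤ B := by
  have h1 : ∀ p, ContDiff ℝ 2 (fun t : ℝ => u (p + t • b)) := fun p =>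
    hu.comp (by fun_prop)
  unfold dirD2
  rw [← iteratedDeriv_fun_sub (h1 p).contDiffAt (h1 q).contDiffAt]
  apply second_le ((h1 p).sub (h1 q))
  filter_upwards [h] with t ht
  refine le_trans (le_of_eq ?_) ht
  simp [sdf, ← sub_eq_add_neg]
  ring

lemma theta_sd {E : Type*} [NormedAddCommGroup E] [InnerProductSpace ℝ E] {σ : ℝ}
    (h0 : 0 < σ) (h1 : σ ≤ 1) (x y : E) :
    sdf (fun z : E => (1 + ‖z‖ ^ 2) ^ (σ / 2)) x y ≤ 2 * min (‖y‖ ^ 2) (‖y‖ ^ σ) := by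
  have hr0 : 0 ≤ σ / 2 := by linarith
  have hr1 : σ / 2 ≤ 1 := by linarith
  have hc := (Real.concaveOn_rpow hr0 hr1).2
    (Set.mem_Ici.2 (by positivity : (0:ℝ) ≤ 1 + ‖x + y‖ ^ 2))
    (Set.mem_Ici.2 (by positivity : (0:ℝ) ≤ 1 + ‖x - y‖ ^ 2))
    (by norm_num : (0:ℝ) ≤ 1/2) (by norm_num : (0:ℝ) ≤ 1/2) (by norm_num)
  have hp : (1/2:ℝ) • (1 + ‖x + y‖ ^ 2) + (1/2:ℝ) • (1 + ‖x - y‖ ^ 2) = (1 + ‖x‖^2) + ‖y‖^2 := by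
    have := parallelogram_law_with_norm ℝ x y
    simp only [smul_eq_mul]
    nlinarith
  rw [hp] at hc
  simp only [smul_eq_mul] at hc
  have hP : (1:ℝ) ≤ 1 + ‖x‖ ^ 2 := by nlinarith [norm_nonneg x]
  have hQ : 0 ≤ ‖y‖ ^ 2 := by positivity
  have k1 : ((1 + ‖x‖^2) + ‖y‖^2) ^ (σ/2) ≤ (1 + ‖x‖^2) ^ (σ/2) + ‖y‖ ^ 2 := by
    generalize 1 + ‖x‖ ^ 2 = P at *
    generalize ‖y‖ ^ 2 = Q at *
    have hP0 : 0 < P := by linarith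
    have : P + Q = P * (1 + Q / P) := by field_simp
    rw [this, Real.mul_rpow hP0.le (by positivity)]
    have e1 : (1 + Q / P) ^ (σ/2) ≤ 1 + Q / P := by
      have hh : 1 ≤ 1 + Q / P := by have : 0 ≤ Q / P := by positivity
                                    linarith
      simpa using Real.rpow_le_rpow_of_exponent_le hh hr1
    have e2 : P ^ (σ/2) ≤ P := by
      simpa using Real.rpow_le_rpow_of_exponent_le hP hr1
    have e3 : 0 ≤ P ^ (σ/2) := by positivity
    calc P ^ (σ/2) * (1 + Q / P) ^ (σ/2) ≤ P ^ (σ/2) * (1 + Q / P) := by gcongr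
      _ = P ^ (σ/2) + P ^ (σ/2) * (Q / P) := by ring
      _ ≤ P ^ (σ/2) + P * (Q / P) := by gcongr
      _ = P ^ (σ/2) + Q := by field_simp
  have k2 : ((1 + ‖x‖^2) + ‖y‖^2) ^ (σ/2) ≤ (1 + ‖x‖^2) ^ (σ/2) + ‖y‖ ^ σ := by
    refine (Real.rpow_add_le_add_rpow (by linarith) hQ hr0 hr1).trans (le_of_eq ?_)
    congr 1
    rw [← Real.rpow_natCast, ← Real.rpow_mul (norm_nonneg y)]
    congr 1
    push_cast; ring
  have : ((1 + ‖x‖^2) + ‖y‖^2) ^ (σ/2) - (1 + ‖x‖^2) ^ (σ/2) ≤ min (‖y‖ ^ 2) (‖y‖ ^ σ) :=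
    le_min (by linarith) (by linarith)
  unfold sdf
  linarith

lemma kern_int (n : ℕ) {s σ : ℝ} (hs : s < 1) (h0 : 0 < σ) (h2 : σ < 2 * s) :
    Integrable (fun y : EuclideanSpace ℝ (Fin n) =>
      min (‖y‖ ^ 2) (‖y‖ ^ σ) / ‖y‖ ^ ((n:ℝ) + 2 * s)) := by
  rcases Nat.eq_zero_or_pos n with rfl | hn
  · exact Integrable.of_finite
  have : Nonempty (Fin n) := ⟨⟨0, hn⟩⟩
  have : Nontrivial (EuclideanSpace ℝ (Fin n)) := inferInstance
  rw [MeasureTheory.integrable_fun_norm_addHaar volume (E := EuclideanSpace ℝ (Fin n))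
    (f := fun r : ℝ => min (r ^ 2) (r ^ σ) / r ^ ((n:ℝ) + 2 * s))]
  have hm : Measurable (fun r : ℝ => r ^ (Module.finrank ℝ (EuclideanSpace ℝ (Fin n)) - 1) •
      (min (r ^ 2) (r ^ σ) / r ^ ((n:ℝ) + 2 * s))) := by
    fun_prop
  rw [← Set.Ioc_union_Ioi_eq_Ioi (zero_le_one' ℝ)]
  have key : ∀ r : ℝ, 0 < r → ∀ q : ℝ, min (r ^ 2) (r ^ σ) ≤ r ^ q →
      ‖r ^ (Module.finrank ℝ (EuclideanSpace ℝ (Fin n)) - 1) •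
      (min (r ^ 2) (r ^ σ) / r ^ ((n:ℝ) + 2 * s))‖ ≤ r ^ (q - 1 - 2 * s) := by
    intro r hr q hq
    rw [Real.norm_of_nonneg (by positivity), finrank_euclideanSpace_fin, smul_eq_mul]
    have : r ^ (q - 1 - 2 * s) = r ^ (n-1) * (r ^ q / r ^ ((n:ℝ) + 2 * s)) := by
      rw [← Real.rpow_natCast, ← Real.rpow_sub hr, ← Real.rpow_add hr, Nat.cast_sub hn]
      congr 1
      push_cast; ring
    rw [this]
    gcongr
  apply IntegrableOn.union
  · have hi : IntegrableOn (fun r : ℝ => r ^ ((2:ℝ) - 1 - 2 * s)) (Set.Ioc 0 1) := by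
      rw [← intervalIntegrable_iff_integrableOn_Ioc_of_le zero_le_one]
      exact intervalIntegral.intervalIntegrable_rpow' (by linarith)
    refine Integrable.mono' hi hm.aestronglyMeasurable ?_
    refine (ae_restrict_iff' measurableSet_Ioc).2 (Eventually.of_forall fun r hr => ?_)
    refine key r hr.1 2 ?_
    rw [Real.rpow_two]
    exact min_le_left _ _
  · have hi : IntegrableOn (fun r : ℝ => r ^ (σ - 1 - 2 * s)) (Set.Ioi 1) :=
      integrableOn_Ioi_rpow_of_lt (by linarith) one_pos
    refine Integrable.mono' hi hm.aestronglyMeasurable ?_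
    refine (ae_restrict_iff' measurableSet_Ioi).2 (Eventually.of_forall fun r hr => ?_)
    exact key r (lt_trans one_pos hr) σ (min_le_right _ _)

lemma kern_scale (n : ℕ) {s σ D : ℝ} (hs : s < 1) (h0 : 0 < σ) (h2 : σ < 2 * s) (hD : 0 < D) :
    Integrable (fun y : EuclideanSpace ℝ (Fin n) =>
      min ((‖y‖ / D) ^ 2) ((‖y‖ / D) ^ σ) / ‖y‖ ^ ((n:ℝ) + 2 * s)) ∧
    ∫ y : EuclideanSpace ℝ (Fin n),
      min ((‖y‖ / D) ^ 2) ((‖y‖ / D) ^ σ) / ‖y‖ ^ ((n:ℝ) + 2 * s) =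
    D ^ (-(2 * s)) * ∫ y : EuclideanSpace ℝ (Fin n),
      min (‖y‖ ^ 2) (‖y‖ ^ σ) / ‖y‖ ^ ((n:ℝ) + 2 * s) := by
  set f : EuclideanSpace ℝ (Fin n) → ℝ := fun y =>
      min (‖y‖ ^ 2) (‖y‖ ^ σ) / ‖y‖ ^ ((n:ℝ) + 2 * s) with hf
  have hE : (fun y : EuclideanSpace ℝ (Fin n) =>
      min ((‖y‖ / D) ^ 2) ((‖y‖ / D) ^ σ) / ‖y‖ ^ ((n:ℝ) + 2 * s)) =
      fun y => D ^ (-((n:ℝ) + 2 * s)) * f (D⁻¹ • y) := by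
    funext y
    have hn : ‖D⁻¹ • y‖ = ‖y‖ / D := by
      rw [norm_smul, norm_inv, Real.norm_of_nonneg hD.le]; ring
    simp only [hf, hn]
    rw [Real.div_rpow (norm_nonneg y) hD.le ((n:ℝ) + 2 * s), Real.rpow_neg hD.le]
    have : D ^ ((n:ℝ) + 2 * s) ≠ 0 := by positivity
    field_simp
  rw [hE]
  constructor
  · exact ((kern_int n hs h0 h2).comp_smul (inv_ne_zero hD.ne')).const_mul _
  · rw [integral_const_mul, Measure.integral_comp_inv_smul_of_nonneg _ _ hD.le,
      finrank_euclideanSpace_fin, smul_eq_mul, ← mul_assoc]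
    congr 1
    rw [← Real.rpow_natCast, ← Real.rpow_add hD]
    congr 1
    ring

lemma norm_grpIncl {ι : Type*} [Fintype ι] [DecidableEq ι] (N : ι → ℕ) (i : ι)
    (y : EuclideanSpace ℝ (Fin (N i))) : ‖grpIncl N i y‖ = ‖y‖ :=
  PiLp.norm_single 2 (fun i : ι => EuclideanSpace ℝ (Fin (N i))) i y

lemma cns_nonneg (n : ℕ) {s : ℝ} (hs : 0 < s) : 0 ≤ cns n s := by
  unfold cns
  have : 0 < Real.Gamma (s + (n:ℝ)/2) := Real.Gamma_pos_of_pos (by positivity)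
  positivity

def Cst (n : ℕ) (s σ : ℝ) : ℝ :=
  if s = 1 then 2 * n else
    cns n s * (2 * ∫ y : EuclideanSpace ℝ (Fin n),
      min (‖y‖ ^ 2) (‖y‖ ^ σ) / ‖y‖ ^ ((n:ℝ) + 2 * s))

lemma Cst_nonneg (n : ℕ) {s : ℝ} (σ : ℝ) (hs : 0 < s) : 0 ≤ Cst n s σ := by
  unfold Cst
  split_ifs
  · positivity
  · refine mul_nonneg (cns_nonneg n hs) (mul_nonneg (by norm_num) (integral_nonneg fun y => ?_))
    positivity

lemma gLap_diff {ι : Type*} [Fintype ι] [DecidableEq ι] (N : ι → ℕ) (i : ι) {s σ A D : ℝ}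
    (hs0 : 0 < s) (hs1 : s ≤ 1) (hσ0 : 0 < σ) (hσ : σ < 2 * s) (hA : 0 ≤ A) (hD : 0 < D)
    {u : GS N → ℝ} (hu : ContDiff ℝ 2 u) {p q : GS N} (hp : gInt N i s u p) (hq : gInt N i s u q)
    (h : ∀ y, sdf u p (grpIncl N i y) - sdf u q (grpIncl N i y) ≤
      A * (2 * min ((‖y‖ / D) ^ 2) ((‖y‖ / D) ^ σ))) :
    -(A * (Cst (N i) s σ * D ^ (-(2 * s)))) ≤ gLap N i s u p - gLap N i s u q := by
  unfold gLap Cst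
  by_cases h1 : s = 1
  · simp only [h1, if_true]
    have key : ∀ j : Fin (N i), dirD2 u p (grpIncl N i (EuclideanSpace.single j 1)) -
        dirD2 u q (grpIncl N i (EuclideanSpace.single j 1)) ≤ A * (2 * D ^ (-(2 * (1:ℝ)))) := by
      intro j
      apply dirD2_le hu
      refine Eventually.of_forall fun t => ?_
      have e : t • grpIncl N i (EuclideanSpace.single j 1) =
          grpIncl N i (t • EuclideanSpace.single j 1) := by
        unfold grpIncl
        rw [Pi.single_smul, WithLp.toLp_smul]
      rw [e]
      refine (h _).trans ?_
      have hn : ‖t • (EuclideanSpace.single j 1 : EuclideanSpace ℝ (Fin (N i)))‖ = |t| := by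
        rw [norm_smul]; simp
      rw [hn]
      have : D ^ (-(2 * (1:ℝ))) = (D ^ 2)⁻¹ := by
        rw [mul_one, Real.rpow_neg hD.le, Real.rpow_two]
      rw [this, mul_assoc, mul_assoc]
      gcongr
      refine (min_le_left _ _).trans (le_of_eq ?_)
      rw [div_pow, sq_abs]; ring
    have := Finset.sum_le_sum fun j (_ : j ∈ Finset.univ) => key j
    rw [Finset.sum_sub_distrib] at this
    simp only [Finset.sum_const, Finset.card_univ, Fintype.card_fin, nsmul_eq_mul] at this
    linarith
  · simp only [h1, if_false]
    have hs : s < 1 := lt_of_le_of_ne hs1 h1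
    have ip := hp.resolve_left h1
    have iq := hq.resolve_left h1
    obtain ⟨ik, ek⟩ := kern_scale (N i) hs hσ0 hσ hD
    rw [← mul_sub, ← integral_sub ip iq]
    have hmono := integral_mono ((ik.const_mul (2 * A)).neg) (ip.sub iq) (fun y => by
      simp only [Pi.neg_apply, Pi.sub_apply]
      have hy := h y
      unfold sdf at hy
      rw [← sub_div, ← mul_div_assoc, ← neg_div]
      apply div_le_div_of_nonneg_right _ (by positivity)
      linarith)
    simp only [Pi.neg_apply, Pi.sub_apply, integral_neg, integral_const_mul, ek] at hmono
    have := mul_le_mul_of_nonneg_left hmono (cns_nonneg (N i) hs0)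
    refine le_trans (le_of_eq ?_) this
    ring

set_option maxHeartbeats 1000000 in
lemma barrier_est {m : ℕ} (N : Fin (m + 1) → ℕ) (hN : N (Fin.last m) = 1)
    (s : Fin (m + 1) → ℝ) (hs : ∀ i, s i ∈ Set.Ioc (0 : ℝ) 1)
    (hsl : s (Fin.last m) = 1)
    (a : Fin (m + 1) → ℝ) (ha : ∀ i, 0 ≤ a i) (S σ : ℝ) (hS0 : 0 < S) (hS1 : S ≤ 1)
    (hS : ∀ i, S ≤ s i) (hσe : σ = 2 * S - 1) (hσ : 0 < σ)
    (u : GS N → ℝ) (hu : ContDiff ℝ 2 u) (hint : ∀ x i, gInt N i (s i) u x)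
    (hL : ∀ x, Lop N a s u x = 0) (e : GS N) (he : ‖e‖ = 1)
    (heL : ∀ x, gLap N (Fin.last m) 1 u x = - dirD2 u x e)
    (K : ℝ) (hK1 : 1 ≤ K)
    (hK : ∑ i : Fin m, a i.castSucc * Cst (N i.castSucc) (s i.castSucc) σ
      < 2 * a (Fin.last m) * K)
    (A R D : ℝ) (hA : 0 < A) (hR : 1 ≤ R) (hD : D = R ^ (1 / S))
    (hside : ∀ z t, 0 ≤ t → t ≤ R → u (z + t • e) - u (z - t • e) ≤
      A * (1 + ‖D⁻¹ • z‖ ^ 2) ^ (σ / 2))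
    (hfar : ∃ ρ, ∀ z t, 0 ≤ t → t ≤ R → ρ < ‖z‖ → u (z + t • e) - u (z - t • e) ≤
      A * ((1 + ‖D⁻¹ • z‖ ^ 2) ^ (σ / 2) - 1))
    (z : GS N) (t : ℝ) (ht0 : 0 ≤ t) (htR : t ≤ R) :
    u (z + t • e) - u (z - t • e) ≤
      A * (K * (t * (2 * R - t)) / R ^ 2 + ((1 + ‖D⁻¹ • z‖ ^ 2) ^ (σ / 2) - 1)) := by
  have hR0 : 0 < R := by linarith
  have hD0 : 0 < D := by rw [hD]; positivity
  have hD1 : 1 ≤ D := by rw [hD]; exact Real.one_le_rpow hR (by positivity)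
  set th : GS N → ℝ := fun z => (1 + ‖z‖ ^ 2) ^ (σ / 2) with hth
  set F : GS N × ℝ → ℝ := fun w => u (w.1 + w.2 • e) - u (w.1 - w.2 • e) -
    A * (K * (w.2 * (2 * R - w.2)) / R ^ 2 + (th (D⁻¹ • w.1) - 1)) with hF
  by_contra hcon
  push Not at hcon
  have hFpos : 0 < F (z, t) := by simp only [hF, hth]; linarith
  have hthc : Continuous th := by
    have : Continuous fun z : GS N => 1 + ‖z‖ ^ 2 := by fun_prop
    exact this.rpow_const fun z => Or.inl (by positivity)
  have hFc : Continuous F := by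
    have := hu.continuous
    fun_prop
  obtain ⟨ρ, hρ⟩ := hfar
  have hKt : ∀ t, 0 ≤ t → t ≤ R → 0 ≤ K * (t * (2 * R - t)) / R ^ 2 := fun t h0 h1 => by
    have : 0 ≤ 2 * R - t := by linarith
    positivity
  have hFfar : ∀ z t, 0 ≤ t → t ≤ R → 0 < F (z, t) → ‖z‖ ≤ ρ := by
    intro z t h0 h1 hp
    by_contra hc
    push Not at hc
    have h2 := hρ z t h0 h1 hc
    have h3 := mul_nonneg hA.le (hKt t h0 h1)
    simp only [hF] at hp
    rw [mul_add] at hp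
    linarith
  obtain ⟨⟨z0, t0⟩, hmem, hmax⟩ := ((isCompact_closedBall (0 : GS N) ρ).prod
    (isCompact_Icc (a := (0:ℝ)) (b := R))).exists_isMaxOn (f := F)
    ⟨(z, t), by simpa using hFfar z t ht0 htR hFpos, ht0, htR⟩ hFc.continuousOn
  have hin : ∀ z t, 0 ≤ t → t ≤ R → 0 < F (z, t) → F (z, t) ≤ F (z0, t0) := by
    intro z t h0 h1 hp
    exact hmax ⟨by simpa using hFfar z t h0 h1 hp, h0, h1⟩
  have hF0 : 0 < F (z0, t0) := hFpos.trans_le (hin z t ht0 htR hFpos)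
  have hall : ∀ z t, 0 ≤ t → t ≤ R → F (z, t) ≤ F (z0, t0) := by
    intro z t h0 h1
    rcases lt_or_ge 0 (F (z, t)) with hp | hp
    · exact hin z t h0 h1 hp
    · linarith
  obtain ⟨-, h00, h0R⟩ := hmem
  simp only at h00 h0R
  have hth1 : ∀ z, 1 ≤ th z := fun z =>
    Real.one_le_rpow (by nlinarith [norm_nonneg z]) (by linarith)
  have ht0pos : 0 < t0 := by
    rcases h00.eq_or_lt with h | h
    · exfalso
      rw [← h] at hF0
      simp only [hF] at hF0
      have := mul_nonneg hA.le (sub_nonneg.2 (hth1 (D⁻¹ • z0)))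
      simp at hF0
      linarith
    · exact h
  have ht0R : t0 < R := by
    rcases h0R.eq_or_lt with h | h
    · exfalso
      rw [h] at hF0
      simp only [hF] at hF0
      have h1 := hside z0 R hR0.le le_rfl
      have h2 : K * (R * (2 * R - R)) / R ^ 2 = K := by field_simp; ring
      rw [h2] at hF0
      have h3 : A * th (D⁻¹ • z0) ≤ A * (K + (th (D⁻¹ • z0) - 1)) := by gcongr; linarith
      simp only [hth] at hF0 h3
      linarith
    · exact h
  set p := z0 + t0 • e with hp
  set q := z0 - t0 • e with hq
  -- spatial second differences
  have hsd : ∀ y : GS N, sdf u p y - sdf u q y ≤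
      A * (2 * min ((‖y‖ / D) ^ 2) ((‖y‖ / D) ^ σ)) := by
    intro y
    have h1 := hall (z0 + y) t0 h00 h0R
    have h2 := hall (z0 - y) t0 h00 h0R
    have h3 := theta_sd hσ (by linarith) (D⁻¹ • z0) (D⁻¹ • y)
    have hn : ‖D⁻¹ • y‖ = ‖y‖ / D := by
      rw [norm_smul, norm_inv, Real.norm_of_nonneg hD0.le]; ring
    rw [hn] at h3
    have h4 := mul_le_mul_of_nonneg_left h3 hA.le
    simp only [sdf, ← smul_add, ← smul_sub] at h4
    simp only [hF, hth] at h1 h2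
    rw [show z0 + y + t0 • e = p + y by rw [hp]; abel,
      show z0 + y - t0 • e = q + y by rw [hq]; abel] at h1
    rw [show z0 - y + t0 • e = p - y by rw [hp]; abel,
      show z0 - y - t0 • e = q - y by rw [hq]; abel] at h2
    unfold sdf
    refine le_trans ?_ h4
    linarith
  have htt : dirD2 u p e - dirD2 u q e ≤ - (2 * A * K / R ^ 2) := by
    apply dirD2_le hu
    have hev : ∀ᶠ τ in nhds (0:ℝ), |τ| < min t0 (R - t0) := by
      have : ContinuousAt (fun τ : ℝ => |τ|) 0 := by fun_prop
      refine this.eventually_lt continuousAt_const ?_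
      simp [ht0pos, ht0R]
    filter_upwards [hev] with τ hτ
    have ha1 := (abs_lt.1 (hτ.trans_le (min_le_left _ _)))
    have ha2 := (abs_lt.1 (hτ.trans_le (min_le_right _ _)))
    have h1 := hall z0 (t0 + τ) (by linarith) (by linarith)
    have h2 := hall z0 (t0 - τ) (by linarith) (by linarith)
    simp only [hF] at h1 h2
    rw [show z0 + (t0 + τ) • e = p + τ • e by rw [hp, add_smul]; abel,
      show z0 - (t0 + τ) • e = q - τ • e by rw [hq, add_smul]; abel] at h1
    rw [show z0 + (t0 - τ) • e = p - τ • e by rw [hp, sub_smul]; abel,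
      show z0 - (t0 - τ) • e = q + τ • e by rw [hq, sub_smul]; abel] at h2
    unfold sdf
    have e1 : K * ((t0 + τ) * (2 * R - (t0 + τ))) / R ^ 2 + K * ((t0 - τ) * (2 * R - (t0 - τ))) / R ^ 2
      = 2 * (K * (t0 * (2 * R - t0)) / R ^ 2) - 2 * K / R ^ 2 * τ ^ 2 := by ring
    have e2 := congrArg (A * ·) e1
    have e3 : -(2 * A * K / R ^ 2) * τ ^ 2 = - (A * (2 * K / R ^ 2 * τ ^ 2)) := by ring
    rw [e3]
    linarith
  have hLp := hL p
  have hLq := hL q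
  unfold Lop at hLp hLq
  rw [Fin.sum_univ_castSucc, hsl, heL] at hLp hLq
  have hDR : ∀ i, D ^ (-(2 * s i)) ≤ (R ^ 2)⁻¹ := by
    intro i
    have e1 : (R ^ 2)⁻¹ = D ^ (-(2 * S)) := by
      rw [hD, ← Real.rpow_mul hR0.le, ← Real.rpow_two, ← Real.rpow_neg hR0.le]
      congr 1
      field_simp
    rw [e1]
    exact Real.rpow_le_rpow_of_exponent_le hD1 (by linarith [hS i])
  have hsum : -(A / R ^ 2 * ∑ i : Fin m, a i.castSucc * Cst (N i.castSucc) (s i.castSucc) σ) ≤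
      ∑ i : Fin m, a i.castSucc * gLap N i.castSucc (s i.castSucc) u p -
      ∑ i : Fin m, a i.castSucc * gLap N i.castSucc (s i.castSucc) u q := by
    rw [← Finset.sum_sub_distrib, Finset.mul_sum, ← Finset.sum_neg_distrib]
    refine Finset.sum_le_sum fun i _ => ?_
    have h1 := gLap_diff N i.castSucc (hs i.castSucc).1 (hs i.castSucc).2 hσ
      (by linarith [hS i.castSucc]) hA.le hD0 hu (hint p _) (hint q _) (fun y => by
        have := hsd (grpIncl N i.castSucc y)
        rwa [norm_grpIncl] at this)
    have h2 : A * (Cst (N i.castSucc) (s i.castSucc) σ * D ^ (-(2 * s i.castSucc))) ≤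
        A * (Cst (N i.castSucc) (s i.castSucc) σ * (R ^ 2)⁻¹) := by
      have := Cst_nonneg (N i.castSucc) σ (hs i.castSucc).1
      gcongr
      exact hDR _
    have h3 := mul_le_mul_of_nonneg_left ((neg_le_neg h2).trans h1) (ha i.castSucc)
    rw [← mul_sub]
    refine le_trans (le_of_eq ?_) h3
    rw [div_eq_mul_inv]; ring
  have h5 := mul_le_mul_of_nonneg_left htt (ha (Fin.last m))
  have h6 := mul_lt_mul_of_pos_left hK (by positivity : 0 < A / R ^ 2)
  have h7 : a (Fin.last m) * -(2 * A * K / R ^ 2) = - (A / R ^ 2 * (2 * a (Fin.last m) * K)) := by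
    ring
  rw [h7] at h5
  linarith

set_option maxHeartbeats 1000000 in
lemma symm_le {m : ℕ} (N : Fin (m + 1) → ℕ) (hN : N (Fin.last m) = 1)
    (s : Fin (m + 1) → ℝ) (hs : ∀ i, s i ∈ Set.Ioc (0 : ℝ) 1)
    (hsl : s (Fin.last m) = 1)
    (a : Fin (m + 1) → ℝ) (ha : ∀ i, 0 ≤ a i) (hal : 0 < a (Fin.last m))
    (S σ : ℝ) (hS0 : 0 < S) (hS1 : S ≤ 1)
    (hS : ∀ i, S ≤ s i) (hσe : σ = 2 * S - 1) (hσ : 0 < σ)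
    (u : GS N → ℝ) (hu : ContDiff ℝ 2 u) (hint : ∀ x i, gInt N i (s i) u x)
    (hL : ∀ x, Lop N a s u x = 0) (e : GS N) (he : ‖e‖ = 1)
    (heL : ∀ x, gLap N (Fin.last m) 1 u x = - dirD2 u x e)
    (hgr : ∀ δ > 0, ∃ ρ : ℝ, ∀ R, ρ ≤ R → ∀ x : GS N, ‖x‖ < R → |u x| ≤ δ * R ^ σ)
    (z : GS N) (t : ℝ) (ht0 : 0 ≤ t) :
    u (z + t • e) - u (z - t • e) ≤ 0 := by
  set Tot := ∑ i : Fin m, a i.castSucc * Cst (N i.castSucc) (s i.castSucc) σ with hTot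
  have hTot0 : 0 ≤ Tot := Finset.sum_nonneg fun i _ =>
    mul_nonneg (ha _) (Cst_nonneg _ σ (hs _).1)
  set K := 1 + Tot / (2 * a (Fin.last m)) with hKd
  have hK1 : 1 ≤ K := by
    have : 0 ≤ Tot / (2 * a (Fin.last m)) := by positivity
    linarith
  have hK : Tot < 2 * a (Fin.last m) * K := by
    have : 2 * a (Fin.last m) * K = 2 * a (Fin.last m) + Tot := by rw [hKd]; field_simp
    linarith
  have hS' : 1 ≤ 1 / S := by rw [le_div_iff₀ hS0]; linarith
  have main : ∀ δ > 0, u (z + t • e) - u (z - t • e) ≤ δ * (12 * K * t + 6 * ‖z‖ ^ 2) := by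
    intro δ hδ
    obtain ⟨ρ0, hρ0⟩ := hgr δ hδ
    obtain ⟨ρ1, hρ1⟩ := hgr (δ / 2) (by linarith)
    set R := max (max ρ0 1) t with hRd
    have hR1 : 1 ≤ R := (le_max_right _ _).trans (le_max_left _ _)
    have hRρ : ρ0 ≤ R := (le_max_left _ _).trans (le_max_left _ _)
    have hRt : t ≤ R := le_max_right _ _
    have hR0 : 0 < R := by linarith
    obtain ⟨D, hD⟩ : ∃ D, D = R ^ (1 / S) := ⟨_, rfl⟩
    have hD0 : 0 < D := by rw [hD]; positivity
    have hDR : R ≤ D := by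
      have := Real.rpow_le_rpow_of_exponent_le hR1 hS'
      rwa [Real.rpow_one, ← hD] at this
    have hD1 : 1 ≤ D := hR1.trans hDR
    have hDσ : D ^ σ ≤ R := by
      rw [hD, ← Real.rpow_mul hR0.le]
      have : 1 / S * σ ≤ 1 := by
        rw [hσe, div_mul_eq_mul_div, div_le_one hS0]; linarith
      simpa using Real.rpow_le_rpow_of_exponent_le hR1 this
    have hDσ0 : 0 < D ^ σ := by positivity
    have hn : ∀ y : GS N, ‖D⁻¹ • y‖ = ‖y‖ / D := fun y => by
      rw [norm_smul, norm_inv, Real.norm_of_nonneg hD0.le]; ring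
    have hpt : ∀ z : GS N, (‖z‖ + 2 * R) ^ σ ≤ 3 * (D ^ σ * (1 + ‖D⁻¹ • z‖ ^ 2) ^ (σ / 2)) := by
      intro z
      have hq : 0 ≤ ‖D⁻¹ • z‖ := norm_nonneg _
      have hzq : ‖z‖ = D * ‖D⁻¹ • z‖ := by rw [hn]; field_simp
      generalize ‖D⁻¹ • z‖ = q at *
      rw [hzq]
      have h1 : D * q + 2 * R ≤ 3 * (D * √(1 + q ^ 2)) := by
        have h2 : 1 ≤ √(1 + q ^ 2) := Real.one_le_sqrt.2 (by nlinarith)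
        have h3 : q ≤ √(1 + q ^ 2) := Real.le_sqrt_of_sq_le (by linarith)
        nlinarith
      refine (Real.rpow_le_rpow (by positivity) h1 hσ.le).trans ?_
      rw [Real.mul_rpow (by norm_num) (by positivity), Real.mul_rpow hD0.le (by positivity),
        Real.sqrt_eq_rpow, ← Real.rpow_mul (by positivity)]
      have h4 : (3:ℝ) ^ σ ≤ 3 := by
        simpa using Real.rpow_le_rpow_of_exponent_le (by norm_num : (1:ℝ) ≤ 3)
          (by linarith : σ ≤ 1)
      have h5 : (1:ℝ) / 2 * σ = σ / 2 := by ring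
      rw [h5]
      gcongr
    have hv : ∀ η : ℝ, ∀ (z : GS N) (t : ℝ), 0 ≤ t → t ≤ R →
        (∀ x : GS N, ‖x‖ < ‖z‖ + 2 * R → |u x| ≤ η * (‖z‖ + 2 * R) ^ σ) →
        u (z + t • e) - u (z - t • e) ≤ 2 * η * (‖z‖ + 2 * R) ^ σ := by
      intro η z t h0 h1 h
      have hte : ‖t • e‖ = t := by rw [norm_smul, he, Real.norm_of_nonneg h0, mul_one]
      have h2 := h (z + t • e) (by
        have := norm_add_le z (t • e); rw [hte] at this; linarith)
      have h3 := h (z - t • e) (by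
        have := norm_sub_le z (t • e); rw [hte] at this; linarith)
      have := (abs_le.1 h2).2
      have := (abs_le.1 h3).1
      linarith
    have hb := barrier_est N hN s hs hsl a ha S σ hS0 hS1 hS hσe hσ u hu hint hL e he heL K hK1 hK
      (6 * δ * D ^ σ) R D (by positivity) hR1 hD ?_ ?_ z t ht0 hRt
    · refine hb.trans ?_
      have h1 : K * (t * (2 * R - t)) / R ^ 2 ≤ 2 * K * t / R := by
        rw [div_le_div_iff₀ (by positivity) hR0]
        have : 0 ≤ K * t * t * R := by positivity
        nlinarith
      have h2 : (1 + ‖D⁻¹ • z‖ ^ 2) ^ (σ / 2) - 1 ≤ ‖z‖ ^ 2 / D := by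
        have h3 : (1 + ‖D⁻¹ • z‖ ^ 2) ^ (σ / 2) ≤ 1 + ‖D⁻¹ • z‖ ^ 2 := by
          simpa using Real.rpow_le_rpow_of_exponent_le
            (by nlinarith [norm_nonneg (D⁻¹ • z)] : (1:ℝ) ≤ 1 + ‖D⁻¹ • z‖ ^ 2)
            (by linarith : σ / 2 ≤ 1)
        have h4 : ‖D⁻¹ • z‖ ^ 2 ≤ ‖z‖ ^ 2 / D := by
          rw [hn, div_pow]
          gcongr
          nlinarith
        linarith
      calc 6 * δ * D ^ σ * (K * (t * (2 * R - t)) / R ^ 2 + ((1 + ‖D⁻¹ • z‖ ^ 2) ^ (σ / 2) - 1))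
          ≤ 6 * δ * R * (2 * K * t / R + ‖z‖ ^ 2 / R) := by
            have h5 : ‖z‖ ^ 2 / D ≤ ‖z‖ ^ 2 / R := by gcongr
            have h6 : 0 ≤ 2 * K * t / R + ‖z‖ ^ 2 / R := by positivity
            calc _ ≤ 6 * δ * D ^ σ * (2 * K * t / R + ‖z‖ ^ 2 / R) := by
                  gcongr
                  exact h2.trans h5
              _ ≤ _ := by gcongr
        _ = _ := by field_simp; ring
    · intro z t h0 h1
      refine (hv δ z t h0 h1 (hρ0 _ (by linarith [norm_nonneg z]))).trans ?_
      have := mul_le_mul_of_nonneg_left (hpt z) (by positivity : 0 ≤ 2 * δ)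
      refine this.trans (le_of_eq ?_)
      ring
    · refine ⟨max ρ1 (D * 2 ^ (1 / σ)), fun z t h0 h1 hz => ?_⟩
      have hz1 := (le_max_left _ _).trans_lt hz
      have hz2 := (le_max_right _ _).trans_lt hz
      have h3 := hv (δ / 2) z t h0 h1 (hρ1 _ (by linarith))
      have h4 := mul_le_mul_of_nonneg_left (hpt z) (by positivity : 0 ≤ 2 * (δ / 2))
      have h5 : 2 ≤ (1 + ‖D⁻¹ • z‖ ^ 2) ^ (σ / 2) := by
        have h6 : (2:ℝ) ^ (1 / σ) ≤ ‖D⁻¹ • z‖ := by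
          rw [hn, le_div_iff₀ hD0]; linarith
        have h7 : (2:ℝ) ^ (2 / σ) ≤ 1 + ‖D⁻¹ • z‖ ^ 2 := by
          have : (2:ℝ) ^ (2 / σ) = ((2:ℝ) ^ (1 / σ)) ^ 2 := by
            rw [← Real.rpow_mul_natCast (by norm_num)]
            congr 1; push_cast; ring
          rw [this]
          have : ((2:ℝ) ^ (1 / σ)) ^ 2 ≤ ‖D⁻¹ • z‖ ^ 2 := by gcongr
          linarith
        have h8 := Real.rpow_le_rpow (by positivity) h7 (by positivity : 0 ≤ σ / 2)
        rw [← Real.rpow_mul (by norm_num)] at h8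
        have : 2 / σ * (σ / 2) = 1 := by field_simp
        rw [this, Real.rpow_one] at h8
        exact h8
      generalize (1 + ‖D⁻¹ • z‖ ^ 2) ^ (σ / 2) = T at *
      refine h3.trans (h4.trans ?_)
      have : 0 ≤ δ * D ^ σ * (T - 2) := mul_nonneg (by positivity) (by linarith)
      nlinarith
  by_contra hcon
  push Not at hcon
  set V := u (z + t • e) - u (z - t • e)
  set B := 12 * K * t + 6 * ‖z‖ ^ 2
  have hB : 0 ≤ B := by positivity
  have := main (V / (2 * (B + 1))) (by positivity)
  have h2 : V / (2 * (B + 1)) * B < V := by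
    rw [div_mul_eq_mul_div, div_lt_iff₀ (by positivity)]
    nlinarith
  linarith

lemma snoc_incl {m : ℕ} (N : Fin (m + 1) → ℕ) (x : GS (fun i : Fin m => N i.castSucc)) (i : Fin m)
    (y : EuclideanSpace ℝ (Fin (N i.castSucc))) (c : ℝ) :
    (WithLp.toLp 2 (Fin.snoc (x + c • grpIncl (fun i : Fin m => N i.castSucc) i y).ofLp 0) : GS N) =
      (WithLp.toLp 2 (Fin.snoc x.ofLp 0) : GS N) + c • grpIncl N i.castSucc y := by
  ext k : 1
  refine Fin.lastCases ?_ (fun k => ?_) k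
  · simp [grpIncl]
  · by_cases h : k = i
    · subst h; simp [grpIncl]
    · simp [grpIncl, h]

/-- Remark 1.5: if `L u = 0` on `ℝ^n`, `u` grows slower than
`R^σ` with `σ = 2 min s_i - 1 > 0`, then the trace `w(x') = u(x',0)` solves
`Σ_{i<m} a_i (-Δ_{X_i})^{s_i} w = 0` on `ℝ^{n-1}`. -/
theorem stmt18 {m : ℕ} (N : Fin (m + 1) → ℕ) (hN : N (Fin.last m) = 1)
    (s : Fin (m + 1) → ℝ) (hs : ∀ i, s i ∈ Set.Ioc (0 : ℝ) 1)
    (hsl : s (Fin.last m) = 1)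
    (a : Fin (m + 1) → ℝ) (ha : ∀ i, 0 ≤ a i) (hal : 0 < a (Fin.last m))
    (hσ : 0 < 2 * (⨅ i, s i) - 1)
    (u : GS N → ℝ) (hsol : IsSol N a s u (fun _ => 0) Set.univ)
    (M : ℝ → ℝ) (hM : ∀ (R : ℝ), ∀ x : GS N, ‖x‖ < R → |u x| ≤ M R)
    (hMo : Filter.Tendsto (fun R : ℝ => M R / R ^ (2 * (⨅ i, s i) - 1))
      Filter.atTop (nhds 0)) :
    ∀ x' : GS (fun i : Fin m => N i.castSucc),
      (∀ i : Fin m, gInt (fun j : Fin m => N j.castSucc) i (s i.castSucc)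
        (fun z => u (WithLp.toLp 2 (Fin.snoc z.ofLp 0))) x') ∧
      (∑ i : Fin m, a i.castSucc * gLap (fun j : Fin m => N j.castSucc) i (s i.castSucc)
        (fun z => u (WithLp.toLp 2 (Fin.snoc z.ofLp 0))) x') = 0 := by
  have hS : ∀ i, (⨅ i, s i) ≤ s i := fun i => ciInf_le (Set.finite_range s).bddBelow i
  have hS0 : 0 < ⨅ i, s i := by linarith
  have hS1 : (⨅ i, s i) ≤ 1 := hsl ▸ hS (Fin.last m)
  have hu : ContDiff ℝ 2 u := contDiff_iff_contDiffAt.2 fun x => (hsol.2 x trivial).1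
  have hint : ∀ x i, gInt N i (s i) u x := fun x => (hsol.2 x trivial).2.1
  have hL : ∀ x, Lop N a s u x = 0 := fun x => (hsol.2 x trivial).2.2
  have hgr : ∀ δ > 0, ∃ ρ : ℝ, ∀ R, ρ ≤ R → ∀ x : GS N, ‖x‖ < R →
      |u x| ≤ δ * R ^ (2 * (⨅ i, s i) - 1) := by
    intro δ hδ
    obtain ⟨ρ, hρ⟩ := eventually_atTop.1 (hMo.eventually_lt_const hδ)
    refine ⟨max ρ 1, fun R hR x hx => (hM R x hx).trans ?_⟩
    have hR0 : 0 < R := by linarith [(le_max_right ρ 1).trans hR]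
    have := hρ R ((le_max_left _ _).trans hR)
    rw [div_lt_iff₀ (by positivity)] at this
    exact this.le
  have hsub : Subsingleton (Fin (N (Fin.last m))) := by rw [hN]; infer_instance
  let j0 : Fin (N (Fin.last m)) := ⟨0, by omega⟩
  let e : GS N := grpIncl N (Fin.last m) (EuclideanSpace.single j0 1)
  have he : ‖e‖ = 1 := by
    simp only [e]
    rw [norm_grpIncl]; simp
  have heL : ∀ x, gLap N (Fin.last m) 1 u x = - dirD2 u x e := by
    intro x
    simp only [gLap, if_true]
    rw [Fintype.sum_eq_single j0 (fun j hj => absurd (Subsingleton.elim j j0) hj)]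
  have heL' : ∀ x, gLap N (Fin.last m) 1 u x = - dirD2 u x (-e) := by
    intro x
    rw [heL]
    congr 1
    unfold dirD2
    have := iteratedDeriv_comp_neg 2 (fun t : ℝ => u (x + t • e)) 0
    simp only [neg_zero] at this
    simp only [smul_neg]
    simpa using this.symm
  have hsymm : ∀ (z : GS N) (t : ℝ), 0 ≤ t → u (z + t • e) = u (z - t • e) := by
    intro z t ht
    have h1 := symm_le N hN s hs hsl a ha hal _ _ hS0 hS1 hS rfl hσ u hu hint hL e he heL hgr z t ht
    have h2 := symm_le N hN s hs hsl a ha hal _ _ hS0 hS1 hS rfl hσ u hu hint hL (-e)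
      (by rwa [norm_neg]) heL' hgr z t ht
    rw [smul_neg, ← sub_eq_add_neg, sub_neg_eq_add] at h2
    linarith
  have hpos : ∀ (z : GS N) (t : ℝ), 0 ≤ t → u (z + t • e) = u z := by
    intro z t ht
    have := hsymm (z + (t / 2) • e) (t / 2) (by linarith)
    rwa [add_assoc, ← add_smul, add_halves, add_sub_cancel_right] at this
  have hconst : ∀ (z : GS N) (t : ℝ), u (z + t • e) = u z := by
    intro z t
    rcases le_total 0 t with h | h
    · exact hpos z t h
    · have := hpos (z + t • e) (-t) (by linarith)
      rw [add_assoc, ← add_smul, add_neg_cancel, zero_smul, add_zero] at this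
      exact this.symm
  have hlast : ∀ x, gLap N (Fin.last m) 1 u x = 0 := by
    intro x
    rw [heL]
    unfold dirD2
    simp only [hconst]
    simp [iteratedDeriv_const]
  intro x'
  have hadd : ∀ (i : Fin m) (y : EuclideanSpace ℝ (Fin (N i.castSucc))),
      (WithLp.toLp 2 (Fin.snoc (x' + grpIncl (fun i : Fin m => N i.castSucc) i y).ofLp 0) : GS N) =
      (WithLp.toLp 2 (Fin.snoc x'.ofLp 0) : GS N) + grpIncl N i.castSucc y := fun i y => by
    simpa only [one_smul] using snoc_incl N x' i y 1
  have hsb : ∀ (i : Fin m) (y : EuclideanSpace ℝ (Fin (N i.castSucc))),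
      (WithLp.toLp 2 (Fin.snoc (x' - grpIncl (fun i : Fin m => N i.castSucc) i y).ofLp 0) : GS N) =
      (WithLp.toLp 2 (Fin.snoc x'.ofLp 0) : GS N) - grpIncl N i.castSucc y := fun i y => by
    simpa only [neg_one_smul, ← sub_eq_add_neg] using snoc_incl N x' i y (-1)
  constructor
  · intro i
    have := hint (WithLp.toLp 2 (Fin.snoc x'.ofLp 0)) i.castSucc
    unfold gInt at this ⊢
    simp only [hadd, hsb]
    exact this
  · have := hL (WithLp.toLp 2 (Fin.snoc x'.ofLp 0))
    unfold Lop at this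
    rw [Fin.sum_univ_castSucc, hsl, hlast, mul_zero, add_zero] at this
    rw [← this]
    refine Finset.sum_congr rfl fun i _ => ?_
    congr 1
    unfold gLap dirD2
    simp only [hadd, hsb, snoc_incl]

end
end

section
/- Let n ≥ 2, s ∈ (1/2, 1), a > 0, and let u : ℝ^n → ℝ be a bounded classical solution in the whole of ℝ^n of Σ_{i=1}^{n-1} (-∂²_{x_i})^s u - a ∂²_{x_n} u = 0, where (-∂²_{x_i})^s u(x) := c_{1,s} ∫_ℝ (2u(x) - u(x + r e_i) - u(x - r e_i)) |r|^{-1-2s} dr. Then u is constant. -/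
open MeasureTheory Real Filter

noncomputable section

lemma aux_d2 (φ : ℝ → ℝ) (hφ : ContDiff ℝ 2 φ) (α β : ℝ)
    (h : ∀ t, φ t ≤ φ 0 + α * t + β * t ^ 2) : iteratedDeriv 2 φ 0 ≤ 2 * β := by
  by_contra! hlt
  have hd : Differentiable ℝ φ := hφ.differentiable (by norm_num)
  have hd1 : Differentiable ℝ (deriv φ) := by
    have : ContDiff ℝ 1 (deriv φ) := by
      have h2 : ContDiff ℝ (1 + 1) φ := by simpa [one_add_one_eq_two] using hφ
      exact (contDiff_succ_iff_deriv.1 h2).2.2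
    exact this.differentiable (by norm_num)
  rw [iteratedDeriv_succ, iteratedDeriv_one] at hlt
  set ψ : ℝ → ℝ := fun t => φ t - (α * t + β * t ^ 2) with hψ
  have hder : deriv ψ = fun t => deriv φ t - (α + 2 * β * t) := by
    funext t
    have h1 := (hd t).hasDerivAt.sub
      (((hasDerivAt_id t).const_mul α).add ((((hasDerivAt_id t).pow 2)).const_mul β))
    have h2 : HasDerivAt ψ (deriv φ t - (α + 2 * β * t)) t := by
      refine (h1.congr_deriv ?_).congr_of_eventuallyEq ?_
      · simp; ring
      · exact Filter.Eventually.of_forall fun z => by simp [hψ]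
    exact h2.deriv
  have hder2 : deriv (deriv ψ) 0 = deriv (deriv φ) 0 - 2 * β := by
    rw [hder]
    have h1 := (hd1 0).hasDerivAt.sub
      (((hasDerivAt_id (0:ℝ)).const_mul (2*β)).const_add α)
    have h2 : HasDerivAt (fun t => deriv φ t - (α + 2 * β * t)) (deriv (deriv φ) 0 - 2 * β) 0 := by
      refine (h1.congr_deriv ?_).congr_of_eventuallyEq ?_
      · simp
      · exact Filter.Eventually.of_forall fun z => by simp
    exact h2.deriv
  have hmax : IsLocalMax ψ 0 := by
    refine Filter.Eventually.of_forall fun t => ?_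
    simp only [hψ]; have := h t; nlinarith
  have hmin : IsLocalMin ψ 0 := by
    apply isLocalMin_of_deriv_deriv_pos
    · rw [hder2]; linarith
    · exact hmax.deriv_eq_zero
    · exact (hd.sub (by fun_prop)).continuous.continuousAt
  have heq : ψ =ᶠ[nhds 0] fun _ => ψ 0 := by
    filter_upwards [hmax, hmin] with t h1 h2
    exact le_antisymm h1 h2
  have h0 : deriv (deriv ψ) 0 = 0 := by
    rw [heq.deriv.deriv_eq]; simp
  rw [hder2] at h0; linarith

lemma aux_ker (s : ℝ) (h0 : 0 < s) (h1 : s < 1) :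
    Integrable (fun r : ℝ => min 1 (r ^ 2) / |r| ^ (1 + 2 * s)) := by
  set g : ℝ → ℝ := fun r : ℝ => min 1 (r ^ 2) / |r| ^ (1 + 2 * s) with hg
  have hpos : IntegrableOn g (Set.Ioi 0) := by
    rw [← Set.Ioc_union_Ioi_eq_Ioi (zero_le_one' ℝ)]
    refine IntegrableOn.union ?_ ?_
    · have := (intervalIntegral.intervalIntegrable_rpow' (a := 0) (b := 1) (r := 1 - 2 * s)
        (by linarith)).1
      refine this.congr_fun (fun r hr => ?_) measurableSet_Ioc
      simp only [hg]
      rw [min_eq_right (by nlinarith [hr.1, hr.2]), abs_of_pos hr.1, ← Real.rpow_natCast,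
        ← Real.rpow_sub hr.1]
      congr 1; push_cast; ring
    · have := integrableOn_Ioi_rpow_of_lt (a := -(1 + 2 * s)) (by linarith) one_pos
      refine this.congr_fun (fun r hr => ?_) measurableSet_Ioi
      have hr' : (1:ℝ) < r := hr
      simp only [hg]
      rw [min_eq_left (by nlinarith), abs_of_pos (by linarith), Real.rpow_neg (by linarith)]
      simp
  rw [← integrableOn_univ, ← Set.Iic_union_Ioi (a := (0:ℝ))]
  refine IntegrableOn.union ?_ hpos
  rw [integrableOn_Iic_iff_integrableOn_Iio]
  have := ((Measure.measurePreserving_neg (volume : Measure ℝ)).integrableOn_comp_preimage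
    (Homeomorph.neg ℝ).measurableEmbedding (f := g) (s := Set.Ioi 0)).2 hpos
  have h3 : (Neg.neg ⁻¹' Set.Ioi (0:ℝ)) = Set.Iio 0 := by ext; simp
  rw [h3] at this
  refine this.congr_fun (fun r hr => ?_) measurableSet_Iio
  simp [hg]

lemma aux_tel (f : ℝ → ℝ) (hf : Continuous f) (M t T : ℝ) (hM : ∀ r, |f r| ≤ M) :
    ∫ r in (0:ℝ)..T, (f (r + t) - f r) ≤ 2 * |t| * M := by
  have hi : ∀ a b, IntervalIntegrable f volume a b := fun a b => hf.intervalIntegrable a b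
  rw [intervalIntegral.integral_sub (show IntervalIntegrable (fun r => f (r + t)) volume 0 T from Continuous.intervalIntegrable (by fun_prop) _ _) (hi _ _)]
  rw [intervalIntegral.integral_comp_add_right, 
    intervalIntegral.integral_interval_sub_interval_comm (hi _ _) (hi _ _) (hi _ _)]
  have e1 := intervalIntegral.norm_integral_le_of_norm_le_const (f := f) (a := 0 + t) (b := 0) (C := M) (fun x _ => hM x)
  have e2 := intervalIntegral.norm_integral_le_of_norm_le_const (f := f) (a := T + t) (b := T) (C := M) (fun x _ => hM x)
  simp only [Real.norm_eq_abs] at e1 e2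
  have : |0 - (0 + t)| = |t| := by simp
  rw [this] at e1
  have : |T - (T + t)| = |t| := by simp
  rw [this] at e2
  have := abs_le.1 e1
  have := abs_le.1 e2
  linarith [this.1]

lemma aux_pert {E : Type*} [NormedAddCommGroup E] [InnerProductSpace ℝ E] [FiniteDimensional ℝ E]
    (n : ℕ) (e : Fin n → E) (v : E) (he : ∀ i, ‖e i‖ = 1) (hv : ‖v‖ = 1)
    (s a c : ℝ) (hs0 : 0 < s) (hs1 : s < 1) (ha : 0 < a) (hc : 0 < c)
    (w : E → ℝ) (hw : ContDiff ℝ 2 w) (m : ℝ) (hm : ∀ x, w x ≤ m)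
    (hint : ∀ x i, Integrable (fun r : ℝ =>
      (2 * w x - w (x + r • e i) - w (x - r • e i)) / |r| ^ (1 + 2 * s)))
    (heq : ∀ x, (∑ i, c * ∫ r : ℝ,
      (2 * w x - w (x + r • e i) - w (x - r • e i)) / |r| ^ (1 + 2 * s)) - a * dirD2 w x v = 0)
    (K : ℝ) (hK : K = ∫ r : ℝ, min 1 (r ^ 2) / |r| ^ (1 + 2 * s))
    (ε : ℝ) (hε : 0 < ε) (x₀ : E) (hx₀ : m - ε < w x₀) :
    ∃ y, m - ε ≤ w y ∧ ∀ j, (∀ r : ℝ, 0 ≤ (2 * w y - w (y + r • e j) - w (y - r • e j))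
        + 4 * ε * min 1 (r ^ 2)) ∧
      ∫ r : ℝ, ((2 * w y - w (y + r • e j) - w (y - r • e j)) + 4 * ε * min 1 (r ^ 2))
        / |r| ^ (1 + 2 * s) ≤ (4 * a / c + n * (4 * K)) * ε := by
  set η : E → ℝ := fun x => max 0 (1 - ‖x - x₀‖ ^ 2) with hη
  have hη0 : ∀ x, 0 ≤ η x := fun x => le_max_left _ _
  have hη1 : ∀ x, η x ≤ 1 := fun x => max_le zero_le_one (by nlinarith [sq_nonneg ‖x - x₀‖])
  have hwc : Continuous w := hw.continuous
  have hWc : Continuous (fun x => w x + 2 * ε * η x) := by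
    simp only [hη]; fun_prop
  obtain ⟨y, hyB, hy⟩ := (isCompact_closedBall x₀ 1).exists_isMaxOn
    ⟨x₀, by simp⟩ hWc.continuousOn
  have hηx₀ : η x₀ = 1 := by simp [hη]
  have hy0 : w x₀ + 2 * ε ≤ w y + 2 * ε * η y := by
    have := hy (show x₀ ∈ Metric.closedBall x₀ 1 by simp)
    simp only [Set.mem_ofPred_eq, hηx₀] at this; linarith
  have hmax : ∀ x, w x + 2 * ε * η x ≤ w y + 2 * ε * η y := by
    intro x
    by_cases hx : x ∈ Metric.closedBall x₀ 1
    · exact hy hx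
    · have h1 : 1 < ‖x - x₀‖ := by simpa [dist_eq_norm] using hx
      have : η x = 0 := max_eq_left (by nlinarith)
      rw [this]; linarith [hm x]
  have hηy : 0 < η y := by
    by_contra! h
    nlinarith [hm y]
  have hηyP : η y = 1 - ‖y - x₀‖ ^ 2 := by
    rcases max_choice 0 (1 - ‖y - x₀‖ ^ 2) with h | h
    · simp only [hη] at hηy; rw [h] at hηy; exact absurd hηy (lt_irrefl _)
    · exact h
  have hquad : ∀ (d : E), ‖d‖ = 1 → ∀ t : ℝ,
      w (y + t • d) ≤ w y + 4 * ε * inner ℝ (y - x₀) d * t + 2 * ε * t ^ 2 := by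
    intro d hd t
    have h1 := hmax (y + t • d)
    have h2 : 1 - ‖y + t • d - x₀‖ ^ 2 ≤ η (y + t • d) := le_max_right _ _
    have h3 : ‖y + t • d - x₀‖ ^ 2 = ‖y - x₀‖ ^ 2 + 2 * (t * inner ℝ (y - x₀) d) + t ^ 2 := by
      have : y + t • d - x₀ = (y - x₀) + t • d := by abel
      rw [this, norm_add_sq_real, inner_smul_right, norm_smul, hd]; simp
    rw [h3] at h2
    have h4 := mul_le_mul_of_nonneg_left h2 (show 0 ≤ 2 * ε by linarith)
    rw [hηyP] at h1
    nlinarith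
  have hD : ∀ j, ∀ r : ℝ, 0 ≤ (2 * w y - w (y + r • e j) - w (y - r • e j))
        + 4 * ε * min 1 (r ^ 2) := by
    intro j r
    rcases min_choice 1 (r ^ 2) with h | h <;> rw [h]
    · have h1 := hmax (y + r • e j)
      have h2 := hmax (y - r • e j)
      nlinarith [mul_nonneg hε.le (hη0 (y + r • e j)), mul_nonneg hε.le (hη0 (y - r • e j)),
        mul_le_mul_of_nonneg_left (hη1 y) hε.le]
    · have h1 := hquad (e j) (he j) r
      have h2 := hquad (e j) (he j) (-r)
      rw [neg_smul, ← sub_eq_add_neg] at h2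
      nlinarith
  have hd2 : dirD2 w y v ≤ 4 * ε := by
    have := aux_d2 (fun t : ℝ => w (y + t • v)) (by fun_prop)
      (4 * ε * inner ℝ (y - x₀) v) (2 * ε) (fun t => by simpa using hquad v hv t)
    unfold dirD2; linarith
  have hker := aux_ker s hs0 hs1
  set I : Fin n → ℝ := fun i => ∫ r : ℝ,
      (2 * w y - w (y + r • e i) - w (y - r • e i)) / |r| ^ (1 + 2 * s) with hI
  have hsplit : ∀ j, ∫ r : ℝ, ((2 * w y - w (y + r • e j) - w (y - r • e j))
      + 4 * ε * min 1 (r ^ 2)) / |r| ^ (1 + 2 * s) = I j + 4 * ε * K := by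
    intro j
    rw [hI, hK, ← integral_const_mul, ← integral_add (hint y j) (hker.const_mul _)]
    congr 1; funext r; ring
  have hnn : ∀ j, 0 ≤ I j + 4 * ε * K := by
    intro j
    rw [← hsplit]
    exact integral_nonneg fun r => div_nonneg (hD j r) (by positivity)
  refine ⟨y, by nlinarith [mul_le_mul_of_nonneg_left (hη1 y) hε.le], fun j => ⟨hD j, ?_⟩⟩
  rw [hsplit]
  have h1 : I j + 4 * ε * K ≤ ∑ i, (I i + 4 * ε * K) :=
    Finset.single_le_sum (f := fun i => I i + 4 * ε * K) (fun i _ => hnn i) (Finset.mem_univ j)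
  have h2 : ∑ i, (I i + 4 * ε * K) = ∑ i, I i + n * (4 * ε * K) := by
    rw [Finset.sum_add_distrib]; simp
  have h3 := heq y
  rw [← Finset.mul_sum] at h3
  have h4 : ∑ i, I i ≤ 4 * a / c * ε := by
    have : c * ∑ i, I i ≤ 4 * a * ε := by
      have : c * ∑ i, I i = a * dirD2 w y v := by linarith
      rw [this]; nlinarith
    rw [div_mul_eq_mul_div, le_div_iff₀ hc]; linarith
  rw [h2] at h1; nlinarith

lemma aux_main {E : Type*} [NormedAddCommGroup E] [InnerProductSpace ℝ E] [FiniteDimensional ℝ E]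
    (n : ℕ) (e : Fin n → E) (v : E) (he : ∀ i, ‖e i‖ = 1) (hv : ‖v‖ = 1)
    (s a c : ℝ) (hs0 : 0 < s) (hs1 : s < 1) (ha : 0 < a) (hc : 0 < c)
    (u : E → ℝ) (hu : ContDiff ℝ 2 u) (M : ℝ) (hM : ∀ x, |u x| ≤ M)
    (hint : ∀ x i, Integrable (fun r : ℝ =>
      (2 * u x - u (x + r • e i) - u (x - r • e i)) / |r| ^ (1 + 2 * s)))
    (heq : ∀ x, (∑ i, c * ∫ r : ℝ,
      (2 * u x - u (x + r • e i) - u (x - r • e i)) / |r| ^ (1 + 2 * s)) - a * dirD2 u x v = 0)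
    (j : Fin n) (t : ℝ) (x : E) : u (x + t • e j) ≤ u x := by
  by_contra! hlt
  have huc : Continuous u := hu.continuous
  set h : E := t • e j with hh
  set w : E → ℝ := fun x => u (x + h) - u x with hwdef
  have hwC : ContDiff ℝ 2 w := by simp only [hwdef]; fun_prop
  have hwc : Continuous w := hwC.continuous
  have hbdd : BddAbove (Set.range w) := by
    refine ⟨2 * M, ?_⟩
    rintro _ ⟨z, rfl⟩
    have := abs_le.1 (hM (z + h)); have := abs_le.1 (hM z)
    simp only [hwdef]; linarith
  set m := ⨆ z, w z with hm
  have hwm : ∀ z, w z ≤ m := fun z => le_ciSup hbdd z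
  have hmpos : 0 < m := lt_of_lt_of_le (by simp only [hwdef]; linarith) (hwm x)
  have hfun : ∀ z i, (fun r : ℝ =>
      (2 * w z - w (z + r • e i) - w (z - r • e i)) / |r| ^ (1 + 2 * s)) = fun r : ℝ =>
      (2 * u (z + h) - u (z + h + r • e i) - u (z + h - r • e i)) / |r| ^ (1 + 2 * s) -
      (2 * u z - u (z + r • e i) - u (z - r • e i)) / |r| ^ (1 + 2 * s) := by
    intro z i; funext r
    have e1 : z + r • e i + h = z + h + r • e i := by abel
    have e2 : z - r • e i + h = z + h - r • e i := by abel
    simp only [hwdef, e1, e2]; ring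
  have hwint : ∀ z i, Integrable (fun r : ℝ =>
      (2 * w z - w (z + r • e i) - w (z - r • e i)) / |r| ^ (1 + 2 * s)) := by
    intro z i; rw [hfun]; exact (hint _ i).sub (hint z i)
  have hd : ∀ z, dirD2 w z v = dirD2 u (z + h) v - dirD2 u z v := by
    intro z
    unfold dirD2
    have h1 : ContDiff ℝ 2 (fun t : ℝ => u (z + h + t • v)) := by fun_prop
    have h2 : ContDiff ℝ 2 (fun t : ℝ => u (z + t • v)) := by fun_prop
    have := iteratedDeriv_sub (n := 2) (x := 0) h1.contDiffAt h2.contDiffAt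
    rw [← this]
    congr 1; funext r
    have e1 : z + r • v + h = z + h + r • v := by abel
    simp [hwdef, e1]
  have hweq : ∀ z, (∑ i, c * ∫ r : ℝ,
      (2 * w z - w (z + r • e i) - w (z - r • e i)) / |r| ^ (1 + 2 * s)) - a * dirD2 w z v = 0 := by
    intro z
    have h1 := heq (z + h)
    have h2 := heq z
    have : ∀ i, (∫ r : ℝ,
      (2 * w z - w (z + r • e i) - w (z - r • e i)) / |r| ^ (1 + 2 * s)) = _ - _ := fun i => by
      rw [hfun]; exact integral_sub (hint (z + h) i) (hint z i)
    simp only [this, mul_sub, Finset.sum_sub_distrib, hd]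
    linarith
  set K := ∫ r : ℝ, min 1 (r ^ 2) / |r| ^ (1 + 2 * s) with hK
  set C := 4 * a / c + n * (4 * K) with hC
  have key : ∀ T : ℝ, 0 < T → ∀ ε : ℝ, 0 < ε →
      2 * T * (m - ε) ≤ 4 * |t| * M + T ^ (1 + 2 * s) * (C * ε) := by
    intro T hT ε hε
    obtain ⟨x₀, hx₀⟩ : ∃ x₀, m - ε < w x₀ := exists_lt_of_lt_ciSup (by linarith)
    obtain ⟨y, hy, hyj⟩ := aux_pert n e v he hv s a c hs0 hs1 ha hc w hwC m hwm hwint hweq K hK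
      ε hε x₀ hx₀
    obtain ⟨hnn, hI⟩ := hyj j
    set G : ℝ → ℝ := fun r => (2 * w y - w (y + r • e j) - w (y - r • e j))
        + 4 * ε * min 1 (r ^ 2) with hG
    have hGc : Continuous G := by simp only [hG]; fun_prop
    have hGint : Integrable (fun r : ℝ => G r / |r| ^ (1 + 2 * s)) := by
      refine ((hwint y j).add ((aux_ker s hs0 hs1).const_mul (4 * ε))).congr ?_
      refine Filter.Eventually.of_forall fun r => ?_
      simp only [hG, Pi.add_apply]; ring
    have h1 : ∫ r in (0:ℝ)..T, G r ≤ T ^ (1 + 2 * s) * (C * ε) := by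
      rw [intervalIntegral.integral_of_le hT.le]
      calc ∫ r in Set.Ioc 0 T, G r
          ≤ ∫ r in Set.Ioc 0 T, T ^ (1 + 2 * s) * (G r / |r| ^ (1 + 2 * s)) := by
            refine setIntegral_mono_on (hGc.integrableOn_Ioc) (hGint.const_mul _).integrableOn
              measurableSet_Ioc ?_
            intro r hr
            rw [abs_of_pos hr.1, mul_div_assoc', le_div_iff₀ (Real.rpow_pos_of_pos hr.1 _),
              mul_comm]
            exact mul_le_mul_of_nonneg_right
              (Real.rpow_le_rpow hr.1.le hr.2 (by linarith)) (hnn r)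
        _ ≤ ∫ r, T ^ (1 + 2 * s) * (G r / |r| ^ (1 + 2 * s)) := by
            refine setIntegral_le_integral (hGint.const_mul _) ?_
            refine Filter.Eventually.of_forall fun r => ?_
            exact mul_nonneg (by positivity) (div_nonneg (hnn r) (by positivity))
        _ ≤ _ := by
            rw [integral_const_mul]
            exact mul_le_mul_of_nonneg_left hI (by positivity)
    have t1 := aux_tel (fun r => u (y + r • e j)) (by fun_prop) M t T (fun r => hM _)
    have t2 := aux_tel (fun r => u (y - r • e j)) (by fun_prop) M (-t) T (fun r => hM _)
    rw [abs_neg] at t2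
    have h2 : ∫ r in (0:ℝ)..T, (2 * (m - ε) - ((u (y + (r + t) • e j) - u (y + r • e j)) +
        (u (y - (r + -t) • e j) - u (y - r • e j)))) ≤ ∫ r in (0:ℝ)..T, G r := by
      refine intervalIntegral.integral_mono_on hT.le ?_ ?_ ?_
      · exact Continuous.intervalIntegrable (by fun_prop) _ _
      · exact hGc.intervalIntegrable _ _
      · intro r _
        have e1 : y + r • e j + h = y + (r + t) • e j := by rw [hh, add_smul]; abel
        have e2 : y - r • e j + h = y - (r + -t) • e j := by
          rw [hh, add_smul, neg_smul]; abel
        have e3 : 0 ≤ 4 * ε * min 1 (r ^ 2) := by positivity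
        have e4 : w (y + r • e j) = u (y + (r + t) • e j) - u (y + r • e j) := by
          rw [← e1]
        have e5 : w (y - r • e j) = u (y - (r + -t) • e j) - u (y - r • e j) := by
          rw [← e2]
        simp only [hG]
        rw [← e4, ← e5]; linarith
    rw [intervalIntegral.integral_sub, intervalIntegral.integral_add,
      intervalIntegral.integral_const] at h2
    · simp only [sub_zero, smul_eq_mul] at h2
      linarith
    all_goals exact Continuous.intervalIntegrable (by fun_prop) _ _
  have key2 : ∀ T : ℝ, 0 < T → 2 * T * m ≤ 4 * |t| * M := by
    intro T hT
    have l1 : Tendsto (fun ε : ℝ => 2 * T * (m - ε)) (nhdsWithin 0 (Set.Ioi 0))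
        (nhds (2 * T * (m - 0))) :=
      (Continuous.tendsto (by fun_prop) 0).mono_left nhdsWithin_le_nhds
    have l2 : Tendsto (fun ε : ℝ => 4 * |t| * M + T ^ (1 + 2 * s) * (C * ε))
        (nhdsWithin 0 (Set.Ioi 0)) (nhds (4 * |t| * M + T ^ (1 + 2 * s) * (C * 0))) :=
      (Continuous.tendsto (by fun_prop) 0).mono_left nhdsWithin_le_nhds
    have := le_of_tendsto_of_tendsto l1 l2
      (by filter_upwards [self_mem_nhdsWithin] with ε hε using key T hT ε hε)
    simpa using this
  have hMnn : 0 ≤ M := (abs_nonneg _).trans (hM x)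
  have := key2 ((4 * |t| * M + 1) / (2 * m)) (by positivity)
  have e : 2 * ((4 * |t| * M + 1) / (2 * m)) * m = 4 * |t| * M + 1 := by field_simp
  linarith

/-- Liouville property, Remark 1.5 with Theorem 2.1 of [SRO]:
a bounded entire solution of `Σ_{i<n} (-∂²_{x_i})^s u - a ∂²_{x_n} u = 0` with
`s ∈ (1/2, 1)` is constant. Here `n = n' + 1 ≥ 2`. -/
theorem stmt19 (n' : ℕ) (hn : 1 ≤ n') (s : ℝ) (hs : s ∈ Set.Ioo (1 / 2 : ℝ) 1)
    (a : ℝ) (haa : 0 < a)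
    (u : EuclideanSpace ℝ (Fin (n' + 1)) → ℝ)
    (hcont : Continuous u) (hreg : ContDiff ℝ 2 u)
    (M : ℝ) (hbd : ∀ x, |u x| ≤ M)
    (hint : ∀ (x : EuclideanSpace ℝ (Fin (n' + 1))) (i : Fin n'),
      MeasureTheory.Integrable (fun r : ℝ =>
        (2 * u x - u (x + r • EuclideanSpace.single i.castSucc 1)
          - u (x - r • EuclideanSpace.single i.castSucc 1)) / |r| ^ (1 + 2 * s)))
    (heq : ∀ x : EuclideanSpace ℝ (Fin (n' + 1)),
      (∑ i : Fin n', cns 1 s *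
        ∫ r : ℝ, (2 * u x - u (x + r • EuclideanSpace.single i.castSucc 1)
          - u (x - r • EuclideanSpace.single i.castSucc 1)) / |r| ^ (1 + 2 * s))
        - a * dirD2 u x (EuclideanSpace.single (Fin.last n') 1) = 0) :
    ∃ c : ℝ, ∀ x, u x = c := by
  obtain ⟨hs0, hs1⟩ := hs
  have hc : 0 < cns 1 s := by
    unfold cns
    have h1 : 0 < Real.Gamma (s + ((1:ℕ) : ℝ) / 2) := Real.Gamma_pos_of_pos (by push_cast; linarith)
    have h2 : Real.Gamma (-s) ≠ 0 := by
      refine Real.Gamma_ne_zero fun k hk => ?_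
      have hk' : s = k := by linarith
      have a1 : (0:ℝ) < k := by linarith
      have a2 : (k:ℝ) < 1 := by linarith
      have a3 : 0 < k := by exact_mod_cast a1
      have a4 : k < 1 := by exact_mod_cast a2
      omega
    have h3 : 0 < |Real.Gamma (-s)| := abs_pos.2 h2
    positivity
  set e : Fin n' → EuclideanSpace ℝ (Fin (n' + 1)) :=
    fun i => EuclideanSpace.single i.castSucc 1 with he
  set v : EuclideanSpace ℝ (Fin (n' + 1)) := EuclideanSpace.single (Fin.last n') 1 with hv
  have hle := aux_main n' e v (fun i => by simp [he]) (by simp [hv]) s a (cns 1 s)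
    (by linarith) hs1 haa hc u hreg M hbd hint heq
  have hinv : ∀ (j : Fin n') (t : ℝ) (x : EuclideanSpace ℝ (Fin (n' + 1))), u (x + t • e j) = u x := by
    intro j t x
    refine le_antisymm (hle j t x) ?_
    have := hle j (-t) (x + t • e j)
    simpa using this
  have hinv' : ∀ (j : Fin n') (t : ℝ) (x : EuclideanSpace ℝ (Fin (n' + 1))), u (x - t • e j) = u x := by
    intro j t x
    have := hinv j (-t) x
    rwa [neg_smul, ← sub_eq_add_neg] at this
  have hd : ∀ x, dirD2 u x v = 0 := by
    intro x
    have h0 : ∀ (i : Fin n') (r : ℝ), u (x + r • EuclideanSpace.single i.castSucc 1) = u x :=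
      fun i r => hinv i r x
    have h0' : ∀ (i : Fin n') (r : ℝ), u (x - r • EuclideanSpace.single i.castSucc 1) = u x :=
      fun i r => hinv' i r x
    have := heq x
    simp only [h0, h0'] at this
    have h1 : 2 * u x - u x - u x = 0 := by ring
    simp only [h1, zero_div, integral_zero, mul_zero, Finset.sum_const_zero, zero_sub] at this
    have h2 : a * dirD2 u x v = 0 := by linarith
    exact (mul_eq_zero.1 h2).resolve_left haa.ne'
  -- one-dimensional profile
  have hg : ContDiff ℝ 2 (fun t : ℝ => u (t • v)) := by fun_prop
  set g : ℝ → ℝ := fun t : ℝ => u (t • v) with hgdef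
  have hgd : Differentiable ℝ g := hg.differentiable (by norm_num)
  have hgd1 : Differentiable ℝ (deriv g) := by
    have h2 : ContDiff ℝ (1 + 1) g := by simpa [one_add_one_eq_two] using hg
    exact (contDiff_succ_iff_deriv.1 h2).2.2.differentiable (by norm_num)
  have hg2 : ∀ t, deriv (deriv g) t = 0 := by
    intro t
    have h1 := hd (t • v)
    unfold dirD2 at h1
    have h2 : (fun r : ℝ => u (t • v + r • v)) = fun r => g (t + r) := by
      funext r; simp [hgdef, add_smul]
    rw [h2, iteratedDeriv_comp_const_add] at h1
    simpa [iteratedDeriv_succ] using h1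
  have hgc : ∀ t, deriv g t = deriv g 0 := fun t => is_const_of_deriv_eq_zero hgd1 hg2 t 0
  have hlin : ∀ t, g t = g 0 + deriv g 0 * t := by
    intro t
    have hD : ∀ z, HasDerivAt (fun z => g z - deriv g 0 * z) 0 z := by
      intro z
      have := (hgd z).hasDerivAt.sub ((hasDerivAt_id z).const_mul (deriv g 0))
      rw [hgc z] at this
      refine (this.congr_deriv (by simp)).congr_of_eventuallyEq ?_
      exact Filter.Eventually.of_forall fun z => by simp
    have := is_const_of_deriv_eq_zero (fun z => (hD z).differentiableAt)
      (fun z => (hD z).deriv) t 0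
    simp at this; linarith
  have hslope : deriv g 0 = 0 := by
    by_contra hne
    have h1 := abs_le.1 (hbd (((2 * M + 1) / deriv g 0) • v))
    have h2 := abs_le.1 (hbd ((0:ℝ) • v))
    have h3 := hlin ((2 * M + 1) / deriv g 0)
    rw [mul_div_cancel₀ _ hne] at h3
    simp only [hgdef] at h3
    linarith [h1.2, h2.1]
  refine ⟨g 0, fun x => ?_⟩
  have hsum : ∀ S : Finset (Fin n'), ∀ z, u (z + ∑ i ∈ S, x i.castSucc • e i) = u z := by
    intro S
    induction S using Finset.induction_on with
    | empty => simp
    | insert i S hi ih =>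
      intro z
      rw [Finset.sum_insert hi, ← add_assoc, ih, hinv]
  have hx : x = x (Fin.last n') • v + ∑ i, x i.castSucc • e i := by
    ext k
    refine Fin.lastCases ?_ (fun i => ?_) k
    · have h0 : ∀ i : Fin n', Fin.last n' ≠ i.castSucc := fun i => (Fin.castSucc_lt_last i).ne'
      simp [he, hv, Pi.single_apply, h0]
    · have h0 : i.castSucc ≠ Fin.last n' := (Fin.castSucc_lt_last i).ne
      simp [he, hv, Pi.single_apply, h0]
  rw [hx, hsum]
  have h1 := hlin (x (Fin.last n'))
  rw [hslope, zero_mul, add_zero] at h1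
  exact h1

end
end
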